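/- arXiv:0909.1125 — 3 statements merged into one kernel-verified Lean document; each statement's English description precedes it below -/
import Mathlib

section
/- Let d be a positive natural number, let Γ be a finitely generated additive subgroup of ℝ^d that is dense in ℝ^d, and let e be an ℝ-linear automorphism of ℝ^d such that the image of Γ under e equals Γ. Then every complex root of the characteristic polynomial of e (with coefficients mapped into ℂ) is an algebraic integer, i.e., is integral over ℤ. -/
/-- An endomorphism of a topological module mapping a dense finitely generated additive subgroup
into itself is integral over `ℤ`. -/
theorem LinearMap.isIntegral_int_of_dense {V : Type*} [AddCommGroup V] [Module ℝ V]
    [TopologicalSpace V] [IsTopologicalAddGroup V] [T2Space V] [ContinuousSMul ℝ V]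
    [FiniteDimensional ℝ V] {Γ : AddSubgroup V} (hfg : Γ.FG) (hd : Dense (Γ : Set V))
    (f : Module.End ℝ V) (hf : ∀ x ∈ Γ, f x ∈ Γ) : IsIntegral ℤ f := by
  let M : Submodule ℤ V := AddSubgroup.toIntSubmodule Γ
  have : Module.Finite ℤ M := Module.Finite.iff_fg.2 <|
    (Submodule.fg_iff_addSubgroup_fg M).2 (by simpa [M] using hfg)
  let g : Module.End ℤ M := (f.restrictScalars ℤ).restrict hf
  obtain ⟨p, hp, hpg⟩ := LinearMap.exists_monic_and_aeval_eq_zero ℤ g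
  refine ⟨p, hp, ?_⟩
  rw [← Polynomial.aeval_def]
  have key (q : Polynomial ℤ) (x : M) :
      ((Polynomial.aeval g q x : M) : V) = Polynomial.aeval f q x := by
    induction q using Polynomial.induction_on generalizing x with
    | C a => simp
    | add q r hq hr => simp [hq, hr]
    | monomial n a ih =>
      rw [pow_succ, ← mul_assoc, map_mul _ (_ * _), map_mul _ (_ * _), Module.End.mul_apply,
        Module.End.mul_apply, ih]
      simp only [Polynomial.aeval_X, Module.End.mul_apply, map_mul]
      rfl
  have hzero : (Polynomial.aeval f p : V → V) = (0 : V → V) :=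
    Continuous.ext_on hd (LinearMap.continuous_of_finiteDimensional _) continuous_const
      fun x hx ↦ by simpa [hpg] using (key p ⟨x, hx⟩).symm
  exact LinearMap.ext fun x ↦ congrFun hzero x

/-- A root, in an extension field, of the characteristic polynomial of an endomorphism which is
integral over `ℤ` is an algebraic integer. -/
theorem LinearMap.isIntegral_of_isRoot_charpoly_map {K L V : Type*} [Field K] [Field L]
    [Algebra K L] [AddCommGroup V] [Module K V] [FiniteDimensional K V] {f : Module.End K V}
    (hf : IsIntegral ℤ f) {z : L} (hz : (f.charpoly.map (algebraMap K L)).IsRoot z) :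
    IsIntegral ℤ z := by
  rw [← LinearMap.charpoly_baseChange, ← Module.End.hasEigenvalue_iff_isRoot_charpoly] at hz
  obtain ⟨p, hp, hpf⟩ := map_isIntegral_int (C := Module.End L (TensorProduct K L V))
    (Module.End.baseChangeHom K L V).toRingHom hf
  obtain ⟨v, hv⟩ := hz.exists_hasEigenvector
  have h := Module.End.aeval_apply_of_hasEigenvector (p := p.map (algebraMap ℤ L)) hv
  rw [Polynomial.aeval_map_algebraMap] at h
  refine ⟨p, hp, ?_⟩
  rw [← Polynomial.eval_map]
  refine (smul_eq_zero.1 (h.symm.trans ?_)).resolve_right hv.2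
  exact congrArg (fun g : Module.End L _ ↦ g v) hpf


theorem charpoly_roots_algebraic_integer
    (d : ℕ) (hd : 0 < d)
    (Γ : AddSubgroup (Fin d → ℝ)) (hΓfg : Γ.FG)
    (hΓdense : Dense (Γ : Set (Fin d → ℝ)))
    (e : (Fin d → ℝ) ≃ₗ[ℝ] (Fin d → ℝ))
    (he : Γ.map e.toLinearMap.toAddMonoidHom = Γ)
    (z : ℂ)
    (hz : (e.toLinearMap.charpoly.map (algebraMap ℝ ℂ)).IsRoot z) :
    IsIntegral ℤ z := by
  exact LinearMap.isIntegral_of_isRoot_charpoly_map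
    (LinearMap.isIntegral_int_of_dense hΓfg hΓdense e.toLinearMap
      fun x hx ↦ he ▸ AddSubgroup.mem_map_of_mem e.toLinearMap.toAddMonoidHom hx) hz
end

section
/- Let n be a positive natural number and let v : Fin n → ℝ be such that the family of real numbers (v i) for i : Fin n is linearly independent over ℚ. Then the set { t • v + m | t ∈ ℝ, m : Fin n → ℤ } (where m is viewed as an element of ℝ^n via coercion) is dense in ℝ^n. Equivalently, the image of the line ℝ·v in the torus ℝ^n / ℤ^n is dense. -/
open Filter Topology in
/-- A closed additive subgroup of a finite-dimensional real vector space that contains no line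
is discrete. -/
theorem AddSubgroup.discreteTopology_of_isClosed_of_forall_smul_mem {E : Type*}
    [NormedAddCommGroup E] [NormedSpace ℝ E] [FiniteDimensional ℝ E] (D : AddSubgroup E)
    (hD : IsClosed (D : Set E)) (hline : ∀ x : E, (∀ t : ℝ, t • x ∈ D) → x = 0) :
    DiscreteTopology D := by
  suffices h : ∃ ε > 0, ∀ x ∈ D, ‖x‖ < ε → x = 0 by
    obtain ⟨ε, hε, h⟩ := h
    refine discreteTopology_of_isOpen_singleton_zero ?_
    convert! (Metric.isOpen_ball : IsOpen (Metric.ball (0 : D) ε))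
    ext x
    simp only [Set.mem_singleton_iff, mem_ball_zero_iff]
    refine ⟨fun hx => by simpa [hx] using hε, fun hx => Subtype.ext (h x x.2 hx)⟩
  by_contra! hcon
  choose x hxD hxlt hx0 using fun k : ℕ => hcon (1 / ((k : ℝ) + 1)) (by positivity)
  have hnorm : Tendsto (fun k => ‖x k‖) atTop (𝓝 0) :=
    squeeze_zero (fun _ => norm_nonneg _) (fun k => (hxlt k).le)
      tendsto_one_div_add_atTop_nhds_zero_nat
  obtain ⟨u, hu, φ, hφ, hlim⟩ := (isCompact_sphere (0 : E) 1).tendsto_subseq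
    (x := fun k => ‖x k‖⁻¹ • x k) (fun k => by simp [norm_smul, hx0 k])
  have hu0 : u = 0 := by
    refine hline u fun t => ?_
    have key : Tendsto (fun k => ⌊t * ‖x (φ k)‖⁻¹⌋ • x (φ k)) atTop (𝓝 (t • u)) := by
      have h1 : Tendsto (fun k => t • (‖x (φ k)‖⁻¹ • x (φ k))) atTop (𝓝 (t • u)) :=
        hlim.const_smul t
      have h2 : Tendsto (fun k => Int.fract (t * ‖x (φ k)‖⁻¹) • x (φ k)) atTop (𝓝 0) := by
        refine squeeze_zero_norm (fun k => ?_) (hnorm.comp hφ.tendsto_atTop)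
        rw [norm_smul, Real.norm_eq_abs, abs_of_nonneg (Int.fract_nonneg _)]
        exact mul_le_of_le_one_left (norm_nonneg _) (Int.fract_lt_one _).le
      have h3 := h1.sub h2
      rw [sub_zero] at h3
      refine h3.congr fun k => ?_
      rw [smul_smul, ← sub_smul, Int.self_sub_fract, Int.cast_smul_eq_zsmul]
    exact hD.mem_of_tendsto key (Eventually.of_forall fun k => D.zsmul_mem (hxD _) _)
  simp [hu0] at hu

/-- A proper closed additive subgroup spanning a finite-dimensional real vector space is contained
in the integrality locus of some nonzero linear functional. -/
theorem AddSubgroup.exists_linearMap_ne_zero_forall_mem_eq_intCast {E : Type*}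
    [NormedAddCommGroup E] [NormedSpace ℝ E] [FiniteDimensional ℝ E] (G : AddSubgroup E)
    (hG : IsClosed (G : Set E)) (hspan : Submodule.span ℝ (G : Set E) = ⊤) (hne : G ≠ ⊤) :
    ∃ f : E →ₗ[ℝ] ℝ, f ≠ 0 ∧ ∀ g ∈ G, ∃ k : ℤ, f g = k := by
  let W : Submodule ℝ E :=
    { carrier := {x | ∀ t : ℝ, t • x ∈ G}
      add_mem' := fun ha hb t => by rw [smul_add]; exact G.add_mem (ha t) (hb t)
      zero_mem' := fun t => by simp
      smul_mem' := fun c x hx t => by rw [smul_smul]; exact hx _ }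
  have hW : ∀ x, x ∈ W ↔ ∀ t : ℝ, t • x ∈ G := fun _ => Iff.rfl
  have hWG : ∀ x ∈ W, x ∈ G := fun x hx => by simpa using hx 1
  obtain ⟨q, hq⟩ := W.exists_isCompl
  let p : E →ₗ[ℝ] q := q.projectionOnto W hq.symm
  have hp : ∀ x, x - p x ∈ W := fun x => Submodule.sub_projection_mem hq.symm x
  let L : Submodule ℤ q := (G.comap q.subtype.toAddMonoidHom).toIntSubmodule
  have hL : ∀ y : q, y ∈ L ↔ (y : E) ∈ G := fun _ => Iff.rfl
  have hpL : ∀ g ∈ G, p g ∈ L := fun g hg => by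
    rw [hL]
    simpa using G.sub_mem hg (hWG _ (hp g))
  have hdisc : DiscreteTopology L := by
    refine AddSubgroup.discreteTopology_of_isClosed_of_forall_smul_mem
      (G.comap q.subtype.toAddMonoidHom) (hG.preimage continuous_subtype_val) fun y hy => ?_
    exact Subtype.ext (Submodule.disjoint_def.1 hq.disjoint y ((hW _).2 hy) y.2)
  have hlat : IsZLattice ℝ L := by
    refine ⟨top_le_iff.1 ?_⟩
    have hmap : Submodule.map p ⊤ = ⊤ := by
      rw [Submodule.map_top]; exact Submodule.range_projectionOnto _
    rw [← hmap, ← hspan, Submodule.map_span]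
    refine Submodule.span_mono ?_
    rintro _ ⟨g, hg, rfl⟩
    exact hpL g hg
  have : Module.Free ℤ L := ZLattice.module_free ℝ L
  let b := Module.Free.chooseBasis ℤ L
  let B := b.ofZLatticeBasis ℝ L
  by_contra! hcon
  refine hne (eq_top_iff.2 fun x _ => ?_)
  have hpx : p x = 0 := by
    refine B.ext_elem fun j => ?_
    have hj : B.coord j ∘ₗ p = 0 := by
      by_contra h0
      obtain ⟨g, hg, hgk⟩ := hcon _ h0
      exact hgk (b.repr ⟨p g, hpL g hg⟩ j) (b.ofZLatticeBasis_repr_apply ℝ L ⟨p g, hpL g hg⟩ j)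
    simpa using LinearMap.congr_fun hj x
  simpa [hpx] using hWG _ (hp x)

theorem dense_line_plus_lattice_of_linearIndependent
    (n : ℕ) (hn : 0 < n) (v : Fin n → ℝ)
    (hv : LinearIndependent ℚ v) :
    Dense {w : Fin n → ℝ | ∃ (t : ℝ) (m : Fin n → ℤ),
      w = t • v + fun i => (m i : ℝ)} := by
  let S : AddSubgroup (Fin n → ℝ) :=
    { carrier := {w | ∃ (t : ℝ) (m : Fin n → ℤ), w = t • v + fun i => (m i : ℝ)}
      add_mem' := by
        rintro _ _ ⟨t, m, rfl⟩ ⟨s, k, rfl⟩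
        refine ⟨t + s, m + k, ?_⟩
        ext i
        simp
        ring
      zero_mem' := ⟨0, 0, by ext i; simp⟩
      neg_mem' := by
        rintro _ ⟨t, m, rfl⟩
        refine ⟨-t, -m, ?_⟩
        ext i
        simp
        ring }
  change Dense (S : Set (Fin n → ℝ))
  have hline : ∀ t : ℝ, t • v ∈ S.topologicalClosure := fun t =>
    S.le_topologicalClosure ⟨t, 0, by ext i; simp⟩
  have hbasis : ∀ i, Pi.basisFun ℝ (Fin n) i ∈ S.topologicalClosure := fun i =>
    S.le_topologicalClosure ⟨0, Pi.single i 1, by ext j; simp [Pi.single_apply]⟩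
  suffices htop : S.topologicalClosure = ⊤ by
    rw [dense_iff_closure_eq, ← AddSubgroup.topologicalClosure_coe, htop, AddSubgroup.coe_top]
  by_contra hne
  obtain ⟨f, hf0, hf⟩ := S.topologicalClosure.exists_linearMap_ne_zero_forall_mem_eq_intCast
    S.isClosed_topologicalClosure
    (top_le_iff.1 <| (Pi.basisFun ℝ (Fin n)).span_eq.ge.trans <|
      Submodule.span_mono <| Set.range_subset_iff.2 hbasis) hne
  have hfv : f v = 0 := by
    by_contra h0
    obtain ⟨k, hk⟩ := hf _ (hline (2 * f v)⁻¹)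
    have h2 : (2 * k : ℝ) = 1 := by
      rw [← hk, map_smul, smul_eq_mul]
      field_simp
    have h3 : 2 * k = 1 := by exact_mod_cast h2
    omega
  choose k hk using fun i => hf _ (hbasis i)
  have hsum : ∑ i, (k i : ℚ) • v i = 0 := by
    have hv_sum := congrArg f ((Pi.basisFun ℝ (Fin n)).sum_repr v)
    rw [← hfv, ← hv_sum, map_sum]
    refine Finset.sum_congr rfl fun i _ => ?_
    rw [map_smul, hk, Rat.smul_def]
    simp [mul_comm]
  refine hf0 ((Pi.basisFun ℝ (Fin n)).ext fun i => ?_)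
  have hki := Fintype.linearIndependent_iff.1 hv (fun i => (k i : ℚ)) hsum i
  rw [hk, Int.cast_eq_zero.1 hki]
  simp
end

section
/- Let p be a prime number and let k be a positive integer. In the group GL(3, ℝ) of invertible 3×3 real matrices, consider the four unipotent upper triangular matrices A₁ with (1,2)-entry 1 and all other off-diagonal entries 0; A₂ with (2,3)-entry 1 and all other off-diagonal entries 0; A₃ with (1,2)-entry k·√p and all other off-diagonal entries 0; and A₄ with (2,3)-entry k·√p and all other off-diagonal entries 0 (all four have diagonal entries equal to 1). Then the topological closure of the subgroup of GL(3, ℝ) generated by {A₁, A₂, A₃, A₄} equals the set of all unipotent upper triangular matrices, i.e., all matrices of the form with rows (1, x, z), (0, 1, y), (0, 0, 1) for x, y, z ∈ ℝ. -/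
open Matrix

/-- The unipotent upper triangular 3×3 real matrix with entries `x, y, z`,
as an element of `GL(3, ℝ)`. -/
noncomputable def unipotent (x y z : ℝ) : GL (Fin 3) ℝ :=
  ⟨!![1, x, z; 0, 1, y; 0, 0, 1],
   !![1, -x, x * y - z; 0, 1, -y; 0, 0, 1],
   by ext i j; fin_cases i <;> fin_cases j <;>
      simp [Matrix.mul_apply, Fin.sum_univ_succ] <;> ring,
   by ext i j; fin_cases i <;> fin_cases j <;>
      simp [Matrix.mul_apply, Fin.sum_univ_succ] <;> ring⟩

theorem unipotent_mul (x y z x' y' z' : ℝ) :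
    unipotent x y z * unipotent x' y' z' =
      unipotent (x + x') (y + y') (z + z' + x * y') := by
  ext i j
  fin_cases i <;> fin_cases j <;>
    simp [unipotent, Matrix.mul_apply, Fin.sum_univ_succ] <;> ring

theorem unipotent_zero : unipotent 0 0 0 = 1 := by
  ext i j
  fin_cases i <;> fin_cases j <;> simp [unipotent]

theorem unipotent_inv (x y z : ℝ) :
    (unipotent x y z)⁻¹ = unipotent (-x) (-y) (x * y - z) := by
  rw [inv_eq_iff_mul_eq_one, unipotent_mul, ← unipotent_zero]
  congr 1 <;> ring

theorem continuous_unipotent :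
    Continuous fun v : ℝ × ℝ × ℝ => unipotent v.1 v.2.1 v.2.2 := by
  refine Units.continuous_iff.2
    ⟨continuous_matrix fun i j => ?_, continuous_matrix fun i j => ?_⟩ <;>
    fin_cases i <;> fin_cases j <;> simp [unipotent] <;> fun_prop

/-- The Heisenberg group of unipotent upper triangular real `3 × 3` matrices. -/
noncomputable def heisenbergSubgroup : Subgroup (GL (Fin 3) ℝ) where
  carrier := {g | ∃ x y z : ℝ, g = unipotent x y z}
  one_mem' := ⟨0, 0, 0, unipotent_zero.symm⟩
  mul_mem' := by
    rintro _ _ ⟨x, y, z, rfl⟩ ⟨x', y', z', rfl⟩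
    exact ⟨_, _, _, unipotent_mul ..⟩
  inv_mem' := by
    rintro _ ⟨x, y, z, rfl⟩
    exact ⟨_, _, _, unipotent_inv ..⟩

theorem isClosed_heisenbergSubgroup :
    IsClosed (heisenbergSubgroup : Set (GL (Fin 3) ℝ)) := by
  have hent : Continuous fun g : GL (Fin 3) ℝ =>
      ((g : Matrix (Fin 3) (Fin 3) ℝ) 0 1, (g : Matrix (Fin 3) (Fin 3) ℝ) 1 2,
        (g : Matrix (Fin 3) (Fin 3) ℝ) 0 2) := by
    have (i j : Fin 3) : Continuous fun g : GL (Fin 3) ℝ =>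
        (g : Matrix (Fin 3) (Fin 3) ℝ) i j :=
      Units.continuous_val.matrix_elem i j
    exact (this 0 1).prodMk ((this 1 2).prodMk (this 0 2))
  convert isClosed_eq continuous_id (continuous_unipotent.comp hent) using 1
  ext g
  refine ⟨?_, fun h => ⟨_, _, _, h⟩⟩
  rintro ⟨x, y, z, rfl⟩
  simp [unipotent]

/-- A closed subgroup containing the values at `1` and at an irrational number of a continuous
one-parameter subgroup contains that whole one-parameter subgroup. -/
theorem Subgroup.mem_of_irrational {G : Type*} [Group G] [TopologicalSpace G]
    {K : Subgroup G} (hK : IsClosed (K : Set G)) (f : Multiplicative ℝ →* G)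
    (hf : Continuous fun t : ℝ => f (Multiplicative.ofAdd t)) {s : ℝ} (hs : Irrational s)
    (h1 : f (Multiplicative.ofAdd 1) ∈ K) (h2 : f (Multiplicative.ofAdd s) ∈ K) (t : ℝ) :
    f (Multiplicative.ofAdd t) ∈ K := by
  have hd : Dense (AddSubgroup.closure {s, 1} : Set ℝ) :=
    dense_addSubgroupClosure_pair_iff.2 (by simpa using hs)
  have hle : AddSubgroup.closure {s, 1} ≤ Subgroup.toAddSubgroup' (K.comap f) := by
    rw [AddSubgroup.closure_le]
    rintro x (rfl | rfl)
    exacts [h2, h1]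
  exact (hK.preimage hf).closure_subset_iff.2 hle (hd t)

theorem closure_of_heisenberg_lattice_generators
    (p : ℕ) (hp : p.Prime) (k : ℕ) (hk : 0 < k) :
    ((Subgroup.closure
        ({unipotent 1 0 0, unipotent 0 1 0,
          unipotent (k * Real.sqrt p) 0 0,
          unipotent 0 (k * Real.sqrt p) 0} :
          Set (GL (Fin 3) ℝ))).topologicalClosure : Set (GL (Fin 3) ℝ)) =
      {g : GL (Fin 3) ℝ | ∃ x y z : ℝ,
        (g : Matrix (Fin 3) (Fin 3) ℝ) = !![1, x, z; 0, 1, y; 0, 0, 1]} := by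
  have hs : Irrational (k * Real.sqrt p) := hp.irrational_sqrt.natCast_mul hk.ne'
  set s : ℝ := k * Real.sqrt p
  set H := Subgroup.closure ({unipotent 1 0 0, unipotent 0 1 0, unipotent s 0 0,
    unipotent 0 s 0} : Set (GL (Fin 3) ℝ)) with hH
  have hgen {g} (hg : g ∈ ({unipotent 1 0 0, unipotent 0 1 0, unipotent s 0 0,
      unipotent 0 s 0} : Set (GL (Fin 3) ℝ))) : g ∈ H.topologicalClosure :=
    H.le_topologicalClosure (Subgroup.subset_closure hg)
  have hx (x : ℝ) : unipotent x 0 0 ∈ H.topologicalClosure :=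
    Subgroup.mem_of_irrational H.isClosed_topologicalClosure
      (MonoidHom.mk' (fun t => unipotent t.toAdd 0 0) fun a b => by simp [unipotent_mul])
      (continuous_unipotent.comp (by fun_prop : Continuous fun t : ℝ => (t, (0 : ℝ), (0 : ℝ))))
      hs (hgen (by simp)) (hgen (by simp)) x
  have hy (y : ℝ) : unipotent 0 y 0 ∈ H.topologicalClosure :=
    Subgroup.mem_of_irrational H.isClosed_topologicalClosure
      (MonoidHom.mk' (fun t => unipotent 0 t.toAdd 0) fun a b => by simp [unipotent_mul])
      (continuous_unipotent.comp (by fun_prop : Continuous fun t : ℝ => ((0 : ℝ), t, (0 : ℝ))))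
      hs (hgen (by simp)) (hgen (by simp)) y
  have hle : H.topologicalClosure ≤ heisenbergSubgroup := by
    refine H.topologicalClosure_minimal ?_ isClosed_heisenbergSubgroup
    rw [hH, Subgroup.closure_le]
    rintro g (rfl | rfl | rfl | rfl) <;> exact ⟨_, _, _, rfl⟩
  ext g
  constructor
  · intro hg
    obtain ⟨x, y, z, rfl⟩ := hle hg
    exact ⟨x, y, z, rfl⟩
  · rintro ⟨x, y, z, hg⟩
    have hfac : g = unipotent 0 (y - z) 0 * unipotent 1 0 0 * unipotent 0 z 0 *
        unipotent (x - 1) 0 0 := by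
      simp only [unipotent_mul]
      ext i j
      simp [hg, unipotent]
    rw [hfac]
    exact mul_mem (mul_mem (mul_mem (hy _) (hx _)) (hy _)) (hx _)
end
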